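/- For all real x > 0, 1/(e^x + 1) = ∫_0^∞ h_f(t) e^{-t x²} dt, where h_f(t) = (4π)^{-1/2} t^{-3/2} ∑_{k=1}^∞ (-1)^{k+1} k·exp(-k²/(4t)). -/

import Mathlib

open Real MeasureTheory Filter Topology Set

theorem tendsto_integral_exp_neg_sq_atTop :
    Tendsto (fun s : ℝ => ∫ y in (0 : ℝ)..s, exp (-y ^ 2)) atTop (𝓝 (√π / 2)) := by
  have h := integral_gaussian_Ioi 1
  have hi := integrable_exp_neg_mul_sq (one_pos (α := ℝ))
  simp only [neg_mul, one_mul, div_one] at h hi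
  rw [← h]
  exact intervalIntegral_tendsto_integral_Ioi 0 hi.integrableOn tendsto_id

theorem tendsto_integral_exp_neg_sq_atBot :
    Tendsto (fun s : ℝ => ∫ y in (0 : ℝ)..s, exp (-y ^ 2)) atBot (𝓝 (-(√π / 2))) := by
  refine ((tendsto_integral_exp_neg_sq_atTop.comp tendsto_neg_atBot_atTop).neg).congr fun s => ?_
  have h := intervalIntegral.integral_comp_neg (a := s) (b := 0) fun y : ℝ => exp (-y ^ 2)
  simp only [neg_zero, neg_sq] at h
  rw [Function.comp_apply, ← h, intervalIntegral.integral_symm, neg_neg]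

theorem hasDerivAt_integral_exp_neg_sq (s : ℝ) :
    HasDerivAt (fun s : ℝ => ∫ y in (0 : ℝ)..s, exp (-y ^ 2)) (exp (-s ^ 2)) s :=
  (by fun_prop : Continuous fun y : ℝ => exp (-y ^ 2)).integral_hasStrictDerivAt 0 s |>.hasDerivAt

/-- An antiderivative of the heat density `t ↦ a / (2√π) t^{-3/2} e^{-a²/(4t) - b² t}`. -/
noncomputable def subordinationPrimitive (a b t : ℝ) : ℝ :=
  -(1 / √π) * (exp (-(a * b)) * (∫ y in (0 : ℝ)..(a / (2 * √t) - b * √t), exp (-y ^ 2)) +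
    exp (a * b) * ∫ y in (0 : ℝ)..(a / (2 * √t) + b * √t), exp (-y ^ 2))

/-- The one-sided stable (Lévy) density, tilted by `e^{-t b²}`. -/
noncomputable def subordinationDensity (a b t : ℝ) : ℝ :=
  (4 * π) ^ (-(1 : ℝ) / 2) * t ^ (-(3 : ℝ) / 2) * (a * exp (-a ^ 2 / (4 * t))) * exp (-t * b ^ 2)

theorem subordinationDensity_nonneg {a t : ℝ} (b : ℝ) (ha : 0 ≤ a) (ht : 0 ≤ t) :
    0 ≤ subordinationDensity a b t := by
  unfold subordinationDensity
  positivity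

theorem hasDerivAt_subordinationPrimitive (a b : ℝ) {t : ℝ} (ht : 0 < t) :
    HasDerivAt (subordinationPrimitive a b) (subordinationDensity a b t) t := by
  have hs : 0 < √t := sqrt_pos.2 ht
  have hsq : √t ^ 2 = t := sq_sqrt ht.le
  have hd := hasDerivAt_sqrt ht.ne'
  have h1 : HasDerivAt (fun t => a / (2 * √t)) (-a / (4 * √t ^ 3)) t := by
    refine ((hasDerivAt_const t a).div (hd.const_mul 2) (by positivity)).congr_deriv ?_
    field_simp
    ring
  have h2 := hd.const_mul b
  have hu := (hasDerivAt_integral_exp_neg_sq _).comp t (h1.sub h2)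
  have hv := (hasDerivAt_integral_exp_neg_sq _).comp t (h1.add h2)
  have h := ((hu.const_mul (exp (-(a * b)))).add (hv.const_mul (exp (a * b)))).const_mul (-(1 / √π))
  refine h.congr_deriv ?_
  have e1 : exp (-(a * b)) * exp (-(a / (2 * √t) - b * √t) ^ 2) =
      exp (-a ^ 2 / (4 * t)) * exp (-t * b ^ 2) := by
    rw [← exp_add, ← exp_add]
    congr 1
    rw [← hsq, sqrt_sq hs.le]
    field_simp
    ring
  have e2 : exp (a * b) * exp (-(a / (2 * √t) + b * √t) ^ 2) =
      exp (-a ^ 2 / (4 * t)) * exp (-t * b ^ 2) := by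
    rw [← exp_add, ← exp_add]
    congr 1
    rw [← hsq, sqrt_sq hs.le]
    field_simp
    ring
  have p1 : (4 * π) ^ (-(1 : ℝ) / 2) = 1 / (2 * √π) := by
    rw [neg_div, rpow_neg (by positivity), ← sqrt_eq_rpow, sqrt_mul (by norm_num),
      show (4 : ℝ) = 2 ^ 2 by norm_num, sqrt_sq (by norm_num), one_div]
  have p2 : t ^ (-(3 : ℝ) / 2) = 1 / √t ^ 3 := by
    rw [neg_div, rpow_neg ht.le, sqrt_eq_rpow, ← rpow_natCast, ← rpow_mul ht.le, one_div]
    norm_num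
  simp only [Pi.sub_apply, Pi.add_apply, ← mul_assoc, e1, e2, subordinationDensity, p1, p2]
  have hp : 0 < √π := sqrt_pos.2 pi_pos
  field_simp
  ring

theorem tendsto_subordinationPrimitive_nhdsGT {a : ℝ} (b : ℝ) (ha : 0 < a) :
    Tendsto (subordinationPrimitive a b) (𝓝[>] 0)
      (𝓝 (-(1 / √π) * (exp (-(a * b)) * (√π / 2) + exp (a * b) * (√π / 2)))) := by
  have hs : Tendsto (fun t : ℝ => √t) (𝓝[>] 0) (𝓝 0) := by
    simpa using (continuous_sqrt.tendsto 0).mono_left nhdsWithin_le_nhds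
  have hs' : Tendsto (fun t : ℝ => √t) (𝓝[>] 0) (𝓝[>] 0) :=
    tendsto_nhdsWithin_iff.2 ⟨hs, by
      filter_upwards [self_mem_nhdsWithin] with t ht using sqrt_pos.2 ht⟩
  have h1 : Tendsto (fun t : ℝ => a / (2 * √t)) (𝓝[>] 0) atTop := by
    refine ((tendsto_inv_nhdsGT_zero.comp hs').const_mul_atTop (half_pos ha)).congr fun t => ?_
    simp only [Function.comp_apply]
    ring
  have h2 := hs.const_mul b
  have hu : Tendsto (fun t : ℝ => a / (2 * √t) - b * √t) (𝓝[>] 0) atTop := by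
    simpa only [sub_eq_add_neg] using h1.atTop_add h2.neg
  have hv := h1.atTop_add h2
  exact (((tendsto_integral_exp_neg_sq_atTop.comp hu).const_mul _).add
    ((tendsto_integral_exp_neg_sq_atTop.comp hv).const_mul _)).const_mul _

theorem tendsto_subordinationPrimitive_atTop (a : ℝ) {b : ℝ} (hb : 0 < b) :
    Tendsto (subordinationPrimitive a b) atTop
      (𝓝 (-(1 / √π) * (exp (-(a * b)) * (-(√π / 2)) + exp (a * b) * (√π / 2)))) := by
  have h1 : Tendsto (fun t : ℝ => a / (2 * √t)) atTop (𝓝 0) :=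
    (tendsto_sqrt_atTop.const_mul_atTop two_pos).const_div_atTop a
  have h2 := tendsto_sqrt_atTop.const_mul_atTop hb
  have hu : Tendsto (fun t : ℝ => a / (2 * √t) - b * √t) atTop atBot := by
    simpa only [sub_eq_add_neg] using h1.add_atBot (tendsto_neg_atBot_iff.2 h2)
  have hv := h1.add_atTop h2
  exact (((tendsto_integral_exp_neg_sq_atBot.comp hu).const_mul _).add
    ((tendsto_integral_exp_neg_sq_atTop.comp hv).const_mul _)).const_mul _

theorem integrableOn_subordinationDensity {a b : ℝ} (ha : 0 < a) (hb : 0 < b) :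
    IntegrableOn (subordinationDensity a b) (Ioi 0) :=
  integrableOn_Ioi_deriv_of_nonneg (g := Function.update (subordinationPrimitive a b) 0 _)
    (continuousWithinAt_update_same.2 <| by
      simpa using tendsto_subordinationPrimitive_nhdsGT b ha)
    (fun t ht => (hasDerivAt_subordinationPrimitive a b ht).congr_of_eventuallyEq <| by
      filter_upwards [eventually_ne_nhds (ne_of_gt ht)] with s hs
      exact Function.update_of_ne hs _ _)
    (fun t ht => subordinationDensity_nonneg b ha.le (le_of_lt ht))
    ((tendsto_subordinationPrimitive_atTop a hb).congr' <| by
      filter_upwards [eventually_ne_atTop 0] with s hs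
      exact (Function.update_of_ne hs _ _).symm)

/-- The subordination identity for the exponential. -/
theorem integral_subordinationDensity {a b : ℝ} (ha : 0 < a) (hb : 0 < b) :
    ∫ t in Ioi (0 : ℝ), subordinationDensity a b t = exp (-(a * b)) := by
  have hp : 0 < √π := sqrt_pos.2 pi_pos
  rw [integral_Ioi_of_hasDerivAt_of_tendsto (f := Function.update (subordinationPrimitive a b) 0 _)
    (continuousWithinAt_update_same.2 <| by
      simpa using tendsto_subordinationPrimitive_nhdsGT b ha)
    (fun t ht => (hasDerivAt_subordinationPrimitive a b ht).congr_of_eventuallyEq <| by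
      filter_upwards [eventually_ne_nhds (ne_of_gt ht)] with s hs
      exact Function.update_of_ne hs _ _)
    (integrableOn_subordinationDensity ha hb)
    ((tendsto_subordinationPrimitive_atTop a hb).congr' <| by
      filter_upwards [eventually_ne_atTop 0] with s hs
      exact (Function.update_of_ne hs _ _).symm), Function.update_self]
  field_simp
  ring

/-- The Fermi function as an alternating geometric series. -/
theorem hasSum_fermi {x : ℝ} (hx : 0 < x) :
    HasSum (fun k : ℕ => (-1 : ℝ) ^ k * exp (-(((k : ℝ) + 1) * x))) (1 / (exp x + 1)) := by
  have h := (hasSum_geometric_of_abs_lt_one (r := -exp (-x)) (by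
    rw [abs_neg, abs_of_pos (exp_pos _)]
    exact exp_lt_one_iff.2 (neg_lt_zero.2 hx))).mul_left (exp (-x))
  have hsum : exp (-x) * (1 - -exp (-x))⁻¹ = 1 / (exp x + 1) := by
    rw [exp_neg]
    have := exp_pos x
    rw [sub_neg_eq_add]
    field_simp
  have hterm (k : ℕ) :
      exp (-x) * (-exp (-x)) ^ k = (-1 : ℝ) ^ k * exp (-(((k : ℝ) + 1) * x)) := by
    rw [neg_pow, ← exp_nat_mul, mul_left_comm, ← exp_add]
    ring_nf
  simpa only [hsum, hterm] using h

/-- Heat kernel representation of the Fermi distribution. -/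
theorem fermi_heat_representation (x : ℝ) (hx : 0 < x) :
    1 / (Real.exp x + 1) =
      ∫ t in Set.Ioi (0 : ℝ),
        ((4 * π) ^ (-(1 : ℝ) / 2) * t ^ (-(3 : ℝ) / 2) *
          ∑' k : ℕ, (-1 : ℝ) ^ k * ((k : ℝ) + 1) * Real.exp (-((k : ℝ) + 1) ^ 2 / (4 * t))) *
        Real.exp (-t * x ^ 2) := by
  have hk (k : ℕ) : (0 : ℝ) < (k : ℝ) + 1 := by positivity
  have hnorm (k : ℕ) :
      ∫ t in Ioi (0 : ℝ), ‖(-1 : ℝ) ^ k * subordinationDensity ((k : ℝ) + 1) x t‖ =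
        exp (-(((k : ℝ) + 1) * x)) := by
    rw [← integral_subordinationDensity (hk k) hx]
    refine setIntegral_congr_fun measurableSet_Ioi fun t ht => ?_
    simp only [norm_mul, norm_pow, norm_neg, norm_one, one_pow, one_mul]
    exact norm_of_nonneg (subordinationDensity_nonneg x (hk k).le (le_of_lt ht))
  have hsum := hasSum_integral_of_summable_integral_norm
    (F := fun (k : ℕ) t => (-1 : ℝ) ^ k * subordinationDensity ((k : ℝ) + 1) x t)
    (fun k => (integrableOn_subordinationDensity (hk k) hx).const_mul _) (by
      simp only [hnorm]
      simpa only [norm_mul, norm_pow, norm_neg, norm_one, one_pow, one_mul,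
        norm_of_nonneg (exp_pos _).le] using (hasSum_fermi hx).summable.norm)
  simp only [integral_const_mul, integral_subordinationDensity (hk _) hx] at hsum
  rw [(hasSum_fermi hx).unique hsum]
  congr 1 with t
  rw [← tsum_mul_left, ← tsum_mul_right]
  refine tsum_congr fun k => ?_
  rw [subordinationDensity]
  ring
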